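/- arXiv:1901.00373 — 2 statements merged into one kernel-verified Lean document; each statement's English description precedes it below -/
import Mathlib

section
/- Potential characterization of equilibria: for every 1 < k ≤ n, a state S is a Nash equilibrium in a k-stable network if and only if S is a local maximizer of the potential on every k-neighborhood containing it, i.e., Φ(S') ≤ Φ(S) for every k-meeting μ = (i, I) and every S' ∈ N_k(μ, S). -/
open Finset

namespace NEkSN

/-- A network state: a profile of binary actions together with a symmetric,
loopless adjacency matrix of friendship links. -/
abbrev NetState (n : ℕ) :=
  {S : (Fin n → Bool) × (Fin n → Fin n → Bool) //
    (∀ i j, S.2 i j = S.2 j i) ∧ ∀ i, S.2 i i = false}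

variable {n : ℕ}

noncomputable section

/-- The (real-valued) action of agent `i`. -/
def act (S : NetState n) (i : Fin n) : ℝ := if S.1.1 i then 1 else 0

/-- The (real-valued) link indicator between `i` and `j`. -/
def lnk (S : NetState n) (i j : Fin n) : ℝ := if S.1.2 i j then 1 else 0

/-- Agent `i`'s utility. -/
def util (v : Fin n → ℝ) (w : Fin n → Fin n → ℝ) (q : Fin n → Fin n → Fin n → ℝ)
    (h φ : ℝ) (i : Fin n) (S : NetState n) : ℝ :=
  act S i * v i
    + ∑ j ∈ univ.erase i, lnk S i j * w i j
    + ∑ j ∈ univ.erase i, ∑ k ∈ univ.erase i,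
        (if j < k then q i j k * lnk S i j * lnk S j k * lnk S k i else 0)
    + h * act S i * ∑ j ∈ univ.erase i, act S j
    + φ * ∑ j ∈ univ.erase i,
        lnk S i j * (act S i * act S j + (1 - act S i) * (1 - act S j))

/-- The potential function. -/
def potential (v : Fin n → ℝ) (w : Fin n → Fin n → ℝ) (q : Fin n → Fin n → Fin n → ℝ)
    (h φ : ℝ) (S : NetState n) : ℝ :=
  (∑ i, act S i * v i)
    + (1 / 2) * ∑ i, ∑ j ∈ univ.erase i, lnk S i j * w i j
    + (h / 2) * ∑ i, ∑ j ∈ univ.erase i, act S i * act S j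
    + (φ / 2) * ∑ i, ∑ j ∈ univ.erase i,
        lnk S i j * (act S i * act S j + (1 - act S i) * (1 - act S j))
    + ∑ i, ∑ j, ∑ k, (if i < j ∧ j < k then q i j k * lnk S i j * lnk S j k * lnk S k i else 0)

/-- The state `S` with `i`'s action set to `b`. -/
def setAct (S : NetState n) (i : Fin n) (b : Bool) : NetState n :=
  ⟨(Function.update S.1.1 i b, S.1.2), S.2⟩

/-- The state `S` with the link between `i` and `j` (`i ≠ j`) set to `b`. -/
def setLink (S : NetState n) (i j : Fin n) (b : Bool) : NetState n :=
  ⟨(S.1.1, fun p q =>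
      if p = q then false
      else if (p = i ∧ q = j) ∨ (p = j ∧ q = i) then b else S.1.2 p q), by
    refine ⟨fun p q => ?_, fun p => ?_⟩
    · by_cases hpq : p = q
      · simp [hpq]
      · have hqp : ¬q = p := fun hc => hpq hc.symm
        simp only [if_neg hpq, if_neg hqp]
        by_cases hc : (p = i ∧ q = j) ∨ (p = j ∧ q = i)
        · rw [if_pos hc, if_pos (by tauto)]
        · rw [if_neg hc, if_neg (by tauto), S.2.1 p q]
    · simp⟩

/-- The state `S` with all links between `i` and members of `D` deleted. -/
def deleteLinks (S : NetState n) (i : Fin n) (D : Finset (Fin n)) : NetState n :=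
  ⟨(S.1.1, fun p q => if (p = i ∧ q ∈ D) ∨ (q = i ∧ p ∈ D) then false else S.1.2 p q), by
    refine ⟨fun p q => ?_, fun p => ?_⟩
    · dsimp only
      by_cases hc : (p = i ∧ q ∈ D) ∨ (q = i ∧ p ∈ D)
      · rw [if_pos hc, if_pos (by tauto)]
      · rw [if_neg hc, if_neg (by tauto), S.2.1 p q]
    · dsimp only
      split
      · rfl
      · exact S.2.2 p⟩

/-- Incremental utility of agent `i` from switching her action on. -/
def dActU (v : Fin n → ℝ) (w : Fin n → Fin n → ℝ) (q : Fin n → Fin n → Fin n → ℝ)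
    (h φ : ℝ) (i : Fin n) (S : NetState n) : ℝ :=
  util v w q h φ i (setAct S i true) - util v w q h φ i (setAct S i false)

/-- Incremental potential from switching `i`'s action on. -/
def dActP (v : Fin n → ℝ) (w : Fin n → Fin n → ℝ) (q : Fin n → Fin n → Fin n → ℝ)
    (h φ : ℝ) (i : Fin n) (S : NetState n) : ℝ :=
  potential v w q h φ (setAct S i true) - potential v w q h φ (setAct S i false)

/-- Incremental utility of agent `i` from the link with `j`. -/
def dLinkU (v : Fin n → ℝ) (w : Fin n → Fin n → ℝ) (q : Fin n → Fin n → Fin n → ℝ)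
    (h φ : ℝ) (i j : Fin n) (S : NetState n) : ℝ :=
  util v w q h φ i (setLink S i j true) - util v w q h φ i (setLink S i j false)

/-- Incremental potential from the link between `i` and `j`. -/
def dLinkP (v : Fin n → ℝ) (w : Fin n → Fin n → ℝ) (q : Fin n → Fin n → Fin n → ℝ)
    (h φ : ℝ) (i j : Fin n) (S : NetState n) : ℝ :=
  potential v w q h φ (setLink S i j true) - potential v w q h φ (setLink S i j false)

/-- A `k`-meeting: an agent `i` together with a set of `k - 1` other agents. -/
abbrev Meeting (n k : ℕ) :=
  {μ : Fin n × Finset (Fin n) // μ.1 ∉ μ.2 ∧ μ.2.card = k - 1}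

/-- The `k`-neighborhood of `S` for meeting `μ = (i, I)`: all states agreeing with `S`
except possibly in `i`'s action and the links between `i` and members of `I`. -/
def nbhd {k : ℕ} (μ : Meeting n k) (S : NetState n) : Finset (NetState n) :=
  univ.filter fun S' =>
    (∀ p, p ≠ μ.1.1 → S'.1.1 p = S.1.1 p) ∧
    (∀ p q, ¬((p = μ.1.1 ∧ q ∈ μ.1.2) ∨ (q = μ.1.1 ∧ p ∈ μ.1.2)) → S'.1.2 p q = S.1.2 p q)

/-- The feasible set for the decision problem of `μ.1` on the neighborhood of `S`:
states in the neighborhood satisfying the stability constraints. -/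
def feasible (v : Fin n → ℝ) (w : Fin n → Fin n → ℝ) (q : Fin n → Fin n → Fin n → ℝ)
    (h φ : ℝ) {k : ℕ} (μ : Meeting n k) (S : NetState n) : Set (NetState n) :=
  {S' | S' ∈ nbhd μ S ∧
    ∀ j ∈ μ.1.2, S'.1.2 μ.1.1 j = true → 0 ≤ dLinkU v w q h φ j μ.1.1 S'}

/-- Nash equilibrium in a `k`(-player) stable network. -/
def isNEkSN (v : Fin n → ℝ) (w : Fin n → Fin n → ℝ) (q : Fin n → Fin n → Fin n → ℝ)
    (h φ : ℝ) (k : ℕ) (S : NetState n) : Prop :=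
  ∀ μ : Meeting n k,
    S ∈ feasible v w q h φ μ S ∧
    ∀ T ∈ feasible v w q h φ μ S, util v w q h φ μ.1.1 T ≤ util v w q h φ μ.1.1 S

/-- One-step transition kernel of the `k`-player consensual dynamic with logit shocks:
`kernel … ρ S' S = P_k(S' | S)`. -/
def kernel (v : Fin n → ℝ) (w : Fin n → Fin n → ℝ) (q : Fin n → Fin n → Fin n → ℝ)
    (h φ : ℝ) (k : ℕ) (ρ : Meeting n k → ℝ) (S' S : NetState n) : ℝ :=
  ∑ μ : Meeting n k,
    if S' ∈ nbhd μ S then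
      ρ μ * Real.exp (potential v w q h φ S') /
        ∑ T ∈ nbhd μ S, Real.exp (potential v w q h φ T)
    else 0

/-- The Gibbs (stationary) distribution `π(S) ∝ exp (Φ S)`. -/
def gibbs (v : Fin n → ℝ) (w : Fin n → Fin n → ℝ) (q : Fin n → Fin n → Fin n → ℝ)
    (h φ : ℝ) (S : NetState n) : ℝ :=
  Real.exp (potential v w q h φ S) / ∑ T : NetState n, Real.exp (potential v w q h φ T)

/-- `m`-step transition probabilities of the `k`CD. -/
def kernelIter (v : Fin n → ℝ) (w : Fin n → Fin n → ℝ) (q : Fin n → Fin n → Fin n → ℝ)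
    (h φ : ℝ) (k : ℕ) (ρ : Meeting n k → ℝ) : ℕ → NetState n → NetState n → ℝ
  | 0, S', S => if S' = S then 1 else 0
  | m + 1, S', S =>
      ∑ T : NetState n, kernel v w q h φ k ρ S' T * kernelIter v w q h φ k ρ m T S

/-- The eigenfunction `e_I` associated with a set `I` of coordinate pairs `(i, j)`, `i ≥ j`:
`(i, i)` refers to the action `a_i` and `(i, j)` with `i > j` to the link `g_{ij}`. -/
def eig (I : Finset (Fin n × Fin n)) (S : NetState n) : ℝ :=
  ∏ p ∈ I,
    if p.1 = p.2 then (if S.1.1 p.1 then (-1 : ℝ) else 1)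
    else (if S.1.2 p.1 p.2 then (-1 : ℝ) else 1)

/-- `I_i = {j ≠ i : (i, j) ∈ I or (j, i) ∈ I}`. -/
def linkedSet (I : Finset (Fin n × Fin n)) (i : Fin n) : Finset (Fin n) :=
  univ.filter fun j => j ≠ i ∧ ((i, j) ∈ I ∨ (j, i) ∈ I)

/-- The eigenvalue `λ_{k,I}`. -/
def lam (k : ℕ) (I : Finset (Fin n × Fin n)) : ℝ :=
  (∑ i ∈ univ.filter (fun i : Fin n => (i, i) ∉ I),
      ((n - 1 - (linkedSet I i).card).choose (k - 1) : ℝ))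
    / (n * ((n - 1).choose (k - 1) : ℝ))

/-- The one-flip neighborhood `N(S)`: states obtained from `S` by flipping exactly one
coordinate (one action or one link). -/
def flipNbhd (S : NetState n) : Set (NetState n) :=
  {S' | (∃ i, S' = setAct S i (!S.1.1 i)) ∨
        ∃ i j, i ≠ j ∧ S' = setLink S i j (!S.1.2 i j)}

end



theorem pair_sum (i : Fin n) (D : Fin n → Fin n → ℝ) (hs : ∀ a b, D a b = D b a)
    (h0 : ∀ a b, a ≠ i → b ≠ i → D a b = 0) :
    ∑ p, ∑ r ∈ univ.erase p, D p r = 2 * ∑ r ∈ univ.erase i, D i r := by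
  have he : ∀ p, ∑ r ∈ univ.erase p, D p r = ∑ r, if r ≠ p then D p r else 0 := by
    intro p
    rw [← Finset.sum_filter]
    congr 1
    ext r; simp
  simp_rw [he]
  have hp : ∀ p r, (if r ≠ p then D p r else 0) =
      (if p = i then (if r ≠ i then D i r else 0) else 0) +
      (if r = i then (if p ≠ i then D i p else 0) else 0) := by
    intro p r
    by_cases h1 : p = i <;> by_cases h2 : r = i
    · simp [h1, h2]
    · simp [h1, h2]
    · subst h2
      simp [h1, Ne.symm h1, hs]
    · simp [h1, h2, h0 p r h1 h2]
  rw [Finset.sum_congr rfl fun p _ => Finset.sum_congr rfl fun r _ => hp p r]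
  simp only [Finset.sum_add_distrib]
  rw [Finset.sum_comm]
  simp
  ring

theorem triple_sum (i : Fin n) (D : Fin n → Fin n → Fin n → ℝ)
    (hs1 : ∀ a b c, D a b c = D b a c) (hs2 : ∀ a b c, D a b c = D a c b)
    (h0 : ∀ a b c, a ≠ i → b ≠ i → c ≠ i → D a b c = 0) :
    ∑ a, ∑ b, ∑ c, (if a < b ∧ b < c then D a b c else 0) =
      ∑ j ∈ univ.erase i, ∑ k ∈ univ.erase i, (if j < k then D i j k else 0) := by
  have he : ∀ f : Fin n → ℝ, ∑ r ∈ univ.erase i, f r = ∑ r, if r ≠ i then f r else 0 := by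
    intro f
    rw [← Finset.sum_filter]
    congr 1
    ext r; simp
  have hp : ∀ a b c, (if a < b ∧ b < c then D a b c else 0) =
      (if a = i then (if i < b ∧ b < c then D i b c else 0) else 0) +
      (if b = i then (if a < i ∧ i < c then D i a c else 0) else 0) +
      (if c = i then (if a < b ∧ b < i then D i a b else 0) else 0) := by
    intro a b c
    by_cases hc : a < b ∧ b < c
    · obtain ⟨hab, hbc⟩ := hc
      have hac := hab.trans hbc
      by_cases h1 : a = i
      · subst h1
        simp [hab, hbc, hab.ne', hac.ne']
      by_cases h2 : b = i
      · subst h2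
        simp [hab, hbc, hab.ne, hbc.ne', hs1 a b c]
      by_cases h3 : c = i
      · subst h3
        simp [hab, hbc, hac.ne, hbc.ne, hs2 a b c, hs1 a c b]
      simp [h1, h2, h3, h0 a b c h1 h2 h3]
    · rw [if_neg hc]
      have g1 : (if a = i then (if i < b ∧ b < c then D i b c else 0) else 0) = 0 := by
        split_ifs with x y
        · subst x; exact absurd y hc
        · rfl
        · rfl
      have g2 : (if b = i then (if a < i ∧ i < c then D i a c else 0) else 0) = 0 := by
        split_ifs with x y
        · subst x; exact absurd y hc
        · rfl
        · rfl
      have g3 : (if c = i then (if a < b ∧ b < i then D i a b else 0) else 0) = 0 := by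
        split_ifs with x y
        · subst x; exact absurd y hc
        · rfl
        · rfl
      rw [g1, g2, g3]; simp
  rw [Finset.sum_congr rfl fun a _ => Finset.sum_congr rfl fun b _ =>
    Finset.sum_congr rfl fun c _ => hp a b c]
  simp only [Finset.sum_add_distrib]
  have e1 : ∑ a, ∑ b, ∑ c, (if a = i then (if i < b ∧ b < c then D i b c else 0) else 0)
      = ∑ b, ∑ c, (if i < b ∧ b < c then D i b c else 0) := by
    rw [Finset.sum_eq_single i]
    · simp
    · intro b _ hb; simp [hb]
    · simp
  have e2 : ∑ a, ∑ b, ∑ c, (if b = i then (if a < i ∧ i < c then D i a c else 0) else 0)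
      = ∑ b, ∑ c, (if b < i ∧ i < c then D i b c else 0) := by
    refine Finset.sum_congr rfl fun a _ => ?_
    rw [Finset.sum_eq_single i]
    · simp
    · intro b _ hb; simp [hb]
    · simp
  have e3 : ∑ a, ∑ b, ∑ c, (if c = i then (if a < b ∧ b < i then D i a b else 0) else 0)
      = ∑ b, ∑ c, (if b < c ∧ c < i then D i b c else 0) := by
    simp
  rw [e1, e2, e3, he]
  simp_rw [he]
  rw [← Finset.sum_add_distrib, ← Finset.sum_add_distrib]
  refine Finset.sum_congr rfl fun b _ => ?_
  rw [← Finset.sum_add_distrib, ← Finset.sum_add_distrib]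
  by_cases hb : b = i
  · subst hb
    simp only [ne_eq, not_true_eq_false, if_false]
    refine Finset.sum_eq_zero fun c _ => ?_
    have g : ¬ (b < c ∧ c < b) := fun h => absurd (h.1.trans h.2) (lt_irrefl _)
    simp [g]
  rw [if_pos hb]
  refine Finset.sum_congr rfl fun c _ => ?_
  by_cases hc : c = i
  · subst hc
    simp
    intro h1 h2; exact absurd (h1.trans h2) (lt_irrefl _)
  rw [if_pos hc]
  by_cases hbc : b < c
  · rcases lt_or_gt_of_ne hb with h1 | h1 <;> rcases lt_or_gt_of_ne hc with h2 | h2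
    · simp [hbc, h1, h2, h1.not_gt, h2.not_gt]
    · simp [hbc, h1, h2, h1.not_gt, h2.not_gt]
    · exact absurd (h1.trans hbc) h2.not_gt
    · simp [hbc, h1, h2, h1.not_gt, h2.not_gt]
  · have : ¬ (b < i ∧ i < c) := fun h => hbc (h.1.trans h.2)
    simp [hbc, this]

theorem lnk_symm (S : NetState n) (a b : Fin n) : lnk S a b = lnk S b a := by
  unfold lnk; rw [S.2.1]

/-- Key lemma: unilateral changes at `i` change utility and potential equally. -/
theorem key (v : Fin n → ℝ) (w : Fin n → Fin n → ℝ) (hw : ∀ i j, w i j = w j i)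
    (q : Fin n → Fin n → Fin n → ℝ)
    (hq1 : ∀ i j k, q i j k = q j i k) (hq2 : ∀ i j k, q i j k = q i k j)
    (h φ : ℝ) (i : Fin n) (S T : NetState n)
    (ha : ∀ p, p ≠ i → S.1.1 p = T.1.1 p)
    (hg : ∀ p r, p ≠ i → r ≠ i → S.1.2 p r = T.1.2 p r) :
    potential v w q h φ S - potential v w q h φ T
      = util v w q h φ i S - util v w q h φ i T := by
  have ha' : ∀ p, p ≠ i → act S p = act T p := fun p hp => by unfold act; rw [ha p hp]
  have hg' : ∀ p r, p ≠ i → r ≠ i → lnk S p r = lnk T p r :=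
    fun p r hp hr => by unfold lnk; rw [hg p r hp hr]
  have t1 : (∑ p, act S p * v p) - (∑ p, act T p * v p) = act S i * v i - act T i * v i := by
    rw [← Finset.sum_sub_distrib]
    refine Finset.sum_eq_single i (fun b _ hb => ?_) (by simp)
    rw [ha' b hb]; ring
  have t2 := pair_sum i (fun a b => lnk S a b * w a b - lnk T a b * w a b)
    (fun a b => by simp only [lnk_symm _ a b, hw a b])
    (fun a b h1 h2 => by simp only [hg' a b h1 h2]; ring)
  have t3 := pair_sum i (fun a b => act S a * act S b - act T a * act T b)
    (fun a b => by ring)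
    (fun a b h1 h2 => by simp only [ha' a h1, ha' b h2]; ring)
  have t4 := pair_sum i (fun a b =>
      lnk S a b * (act S a * act S b + (1 - act S a) * (1 - act S b))
      - lnk T a b * (act T a * act T b + (1 - act T a) * (1 - act T b)))
    (fun a b => by simp only [lnk_symm _ a b]; ring)
    (fun a b h1 h2 => by simp only [hg' a b h1 h2, ha' a h1, ha' b h2]; ring)
  have t5 := triple_sum i (fun a b c =>
      q a b c * lnk S a b * lnk S b c * lnk S c a - q a b c * lnk T a b * lnk T b c * lnk T c a)
    (fun a b c => by
      rw [hq1 a b c, lnk_symm S a b, lnk_symm T a b, lnk_symm S b c, lnk_symm T b c,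
        lnk_symm S c a, lnk_symm T c a]; ring)
    (fun a b c => by
      rw [hq2 a b c, lnk_symm S a b, lnk_symm T a b, lnk_symm S b c, lnk_symm T b c,
        lnk_symm S c a, lnk_symm T c a]; ring)
    (fun a b c h1 h2 h3 => by simp only [hg' a b h1 h2, hg' b c h2 h3, hg' c a h3 h1]; ring)
  have ite_sub' : ∀ (P : Prop) [Decidable P] (x y : ℝ),
      (if P then x - y else 0) = (if P then x else 0) - (if P then y else 0) := by
    intro P _ x y; split_ifs <;> simp
  simp only [ite_sub', Finset.sum_sub_distrib] at t2 t3 t4 t5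
  rw [← Finset.mul_sum, ← Finset.mul_sum] at t3
  unfold potential util
  linear_combination t1 + (1/2) * t2 + (h/2) * t3 + (φ/2) * t4 + t5

theorem dLink_eq (v : Fin n → ℝ) (w : Fin n → Fin n → ℝ) (hw : ∀ i j, w i j = w j i)
    (q : Fin n → Fin n → Fin n → ℝ)
    (hq1 : ∀ i j k, q i j k = q j i k) (hq2 : ∀ i j k, q i j k = q i k j)
    (h φ : ℝ) (i j : Fin n) (S : NetState n) :
    dLinkU v w q h φ i j S = dLinkP v w q h φ i j S := by
  unfold dLinkU dLinkP
  rw [key v w hw q hq1 hq2 h φ i]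
  · intro p _; rfl
  · intro p r hp hr
    simp [setLink, hp, hr]

theorem setLink_self (S : NetState n) (i j : Fin n) (hij : S.1.2 i j = true) :
    setLink S j i true = S := by
  apply Subtype.ext
  refine Prod.ext rfl ?_
  funext p r
  simp only [setLink]
  by_cases hpr : p = r
  · subst hpr; simp [S.2.2]
  rw [if_neg hpr]
  split_ifs with hc
  · rcases hc with ⟨rfl, rfl⟩ | ⟨rfl, rfl⟩
    · rw [S.2.1, hij]
    · exact hij.symm
  · rfl

/-- A potential maximizer on the neighborhood is feasible. -/
theorem max_feasible (v : Fin n → ℝ) (w : Fin n → Fin n → ℝ) (hw : ∀ i j, w i j = w j i)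
    (q : Fin n → Fin n → Fin n → ℝ)
    (hq1 : ∀ i j k, q i j k = q j i k) (hq2 : ∀ i j k, q i j k = q i k j)
    (h φ : ℝ) {k : ℕ} (μ : Meeting n k) (S T : NetState n) (hT : T ∈ nbhd μ S)
    (hmax : ∀ S' ∈ nbhd μ S, potential v w q h φ S' ≤ potential v w q h φ T) :
    T ∈ feasible v w q h φ μ S := by
  refine ⟨hT, fun j hj hl => ?_⟩
  rw [dLink_eq v w hw q hq1 hq2, dLinkP, setLink_self T _ _ hl, sub_nonneg]
  apply hmax
  simp only [nbhd, Finset.mem_filter, Finset.mem_univ, true_and] at hT ⊢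
  refine ⟨hT.1, fun p r hpr => ?_⟩
  rw [← hT.2 p r hpr]
  simp only [setLink]
  by_cases he : p = r
  · subst he; simp [T.2.2]
  rw [if_neg he, if_neg]
  rintro (⟨rfl, rfl⟩ | ⟨rfl, rfl⟩)
  · exact hpr (Or.inr ⟨rfl, hj⟩)
  · exact hpr (Or.inl ⟨rfl, hj⟩)

theorem self_mem_nbhd {k : ℕ} (μ : Meeting n k) (S : NetState n) : S ∈ nbhd μ S := by
  simp [nbhd]

theorem key_nbhd (v : Fin n → ℝ) (w : Fin n → Fin n → ℝ) (hw : ∀ i j, w i j = w j i)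
    (q : Fin n → Fin n → Fin n → ℝ)
    (hq1 : ∀ i j k, q i j k = q j i k) (hq2 : ∀ i j k, q i j k = q i k j)
    (h φ : ℝ) {k : ℕ} (μ : Meeting n k) (S T : NetState n) (hT : T ∈ nbhd μ S) :
    potential v w q h φ T - potential v w q h φ S
      = util v w q h φ μ.1.1 T - util v w q h φ μ.1.1 S := by
  simp only [nbhd, Finset.mem_filter, Finset.mem_univ, true_and] at hT
  refine key v w hw q hq1 hq2 h φ _ T S hT.1 fun p r hp hr => hT.2 p r ?_
  tauto

/-- a state is a Nash equilibrium in a `k`-stable network iff it is a local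
maximizer of the potential on every `k`-neighborhood containing it. -/
theorem neksn_iff_local_potential_max {n : ℕ} (hn : 2 ≤ n)
    (v : Fin n → ℝ) (w : Fin n → Fin n → ℝ) (hw : ∀ i j, w i j = w j i)
    (q : Fin n → Fin n → Fin n → ℝ)
    (hq1 : ∀ i j k, q i j k = q j i k) (hq2 : ∀ i j k, q i j k = q i k j)
    (h φ : ℝ) (k : ℕ) (hk1 : 1 < k) (hk2 : k ≤ n) (S : NetState n) :
    isNEkSN v w q h φ k S ↔
      ∀ (μ : Meeting n k), ∀ S' ∈ nbhd μ S,
        potential v w q h φ S' ≤ potential v w q h φ S := by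
  constructor
  · intro hNE μ S' hS'
    obtain ⟨T, hT, hmax⟩ := Finset.exists_max_image (nbhd μ S) (potential v w q h φ) ⟨S', hS'⟩
    have h1 := (hNE μ).2 T (max_feasible v w hw q hq1 hq2 h φ μ S T hT hmax)
    have h2 := key_nbhd v w hw q hq1 hq2 h φ μ S T hT
    have h3 := hmax S' hS'
    linarith
  · intro hmax μ
    refine ⟨max_feasible v w hw q hq1 hq2 h φ μ S S (self_mem_nbhd μ S) (hmax μ), ?_⟩
    intro T hT
    have h2 := key_nbhd v w hw q hq1 hq2 h φ μ S T hT.1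
    have h3 := hmax μ T hT.1
    linarith

end NEkSN
end

section
/- Nesting of equilibria (Proposition 2, part 3): the equilibria in the NEkSN family are ordered by set inclusion; for all 1 < k ≤ k' ≤ n, every Nash equilibrium in a k'-stable network is also a Nash equilibrium in a k-stable network, i.e., NEk'SN ⊆ NEkSN. -/
open Finset

namespace NEkSN

variable {n : ℕ}

theorem lnk_comm' (S : NetState n) (i j : Fin n) : lnk S i j = lnk S j i := by
  unfold lnk; rw [S.2.1 i j]

theorem lnk_self' (S : NetState n) (i : Fin n) : lnk S i i = 0 := by
  unfold lnk; rw [S.2.2 i]; simp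

/-- The triangle term, summed over all ordered pairs. -/
theorem triangle_eq (q : Fin n → Fin n → Fin n → ℝ) (hq2 : ∀ i j k, q i j k = q i k j)
    (i : Fin n) (S : NetState n) :
    ∑ j ∈ univ.erase i, ∑ k ∈ univ.erase i,
        (if j < k then q i j k * lnk S i j * lnk S j k * lnk S k i else 0)
      = (1 / 2) * ∑ j, ∑ k, q i j k * lnk S i j * lnk S j k * lnk S k i := by
  set F : Fin n → Fin n → ℝ := fun j k => q i j k * lnk S i j * lnk S j k * lnk S k i with hF
  have hsym : ∀ j k, F j k = F k j := by
    intro j k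
    simp only [hF]
    rw [hq2 i j k, lnk_comm' S i j, lnk_comm' S j k, lnk_comm' S k i]
    ring
  have h1 : ∑ j ∈ univ.erase i, ∑ k ∈ univ.erase i, (if j < k then F j k else 0)
      = ∑ j, ∑ k, (if j < k then F j k else 0) := by
    rw [Finset.sum_erase]
    · refine Finset.sum_congr rfl fun j _ => ?_
      rw [Finset.sum_erase]
      simp [hF, lnk_self']
    · simp [hF, lnk_self']
  have h2 : ∑ j, ∑ k, (if j < k then F j k else 0) = ∑ j, ∑ k, (if k < j then F j k else 0) := by
    rw [Finset.sum_comm]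
    refine Finset.sum_congr rfl fun j _ => Finset.sum_congr rfl fun k _ => ?_
    rw [hsym]
  have h3 : ∑ j, ∑ k, F j k = ∑ j, ∑ k, (if j < k then F j k else 0)
      + ∑ j, ∑ k, (if k < j then F j k else 0) := by
    rw [← Finset.sum_add_distrib]
    refine Finset.sum_congr rfl fun j _ => ?_
    rw [← Finset.sum_add_distrib]
    refine Finset.sum_congr rfl fun k _ => ?_
    rcases lt_trichotomy j k with hl | hl | hl
    · simp [hl, not_lt.mpr hl.le]
    · subst hl
      simp [hF, lnk_self']
    · simp [hl, not_lt.mpr hl.le]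
  change ∑ j ∈ univ.erase i, ∑ k ∈ univ.erase i, (if j < k then F j k else 0)
      = (1 / 2) * ∑ j, ∑ k, F j k
  rw [h1, h3, ← h2]
  ring

theorem lnk_setLink_true (S : NetState n) (a b : Fin n) (hab : a ≠ b) (x : Fin n) :
    lnk (setLink S a b true) a x = lnk (setLink S a b false) a x + if x = b then 1 else 0 := by
  unfold lnk setLink
  by_cases hx : x = b
  · subst hx; simp [hab]
  · simp [hx, hab]

theorem lnk_setLink_other (S : NetState n) (a b : Fin n) (x y : Fin n) (hx : x ≠ a)
    (hy : y ≠ a) (c : Bool) :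
    lnk (setLink S a b c) x y = lnk S x y := by
  unfold lnk setLink
  by_cases hxy : x = y
  · subst hxy; simp [S.2.2 x]
  · simp [hx, hy, hxy]

theorem setLink_comm' (S : NetState n) (a b : Fin n) (c : Bool) :
    setLink S a b c = setLink S b a c := by
  apply Subtype.ext
  unfold setLink
  simp only [Prod.mk.injEq, true_and]
  funext p q
  congr 2
  exact propext (by tauto)

theorem act_setLink (S : NetState n) (a b : Fin n) (c : Bool) (x : Fin n) :
    act (setLink S a b c) x = act S x := rfl

theorem dLinkU_eq (v : Fin n → ℝ) (w : Fin n → Fin n → ℝ) (q : Fin n → Fin n → Fin n → ℝ)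
    (hq2 : ∀ i j k, q i j k = q i k j)
    (h φ : ℝ) (a b : Fin n) (hab : a ≠ b) (S : NetState n) :
    dLinkU v w q h φ a b S = w a b
      + φ * (act S a * act S b + (1 - act S a) * (1 - act S b))
      + ∑ k, q a b k * lnk (setLink S a b false) b k * lnk (setLink S a b false) k a := by
  unfold dLinkU util
  rw [triangle_eq q hq2, triangle_eq q hq2]
  simp only [act_setLink]
  set S1 := setLink S a b true with hS1
  set S0 := setLink S a b false with hS0
  have hl : ∀ x, lnk S1 a x = lnk S0 a x + if x = b then 1 else 0 := lnk_setLink_true S a b hab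
  have hT : ∑ j, ∑ k, q a j k * lnk S1 a j * lnk S1 j k * lnk S1 k a
      = ∑ j, ∑ k, q a j k * lnk S0 a j * lnk S0 j k * lnk S0 k a
        + 2 * ∑ k, q a b k * lnk S0 b k * lnk S0 k a := by
    have hp : ∀ j k, q a j k * lnk S1 a j * lnk S1 j k * lnk S1 k a
        = q a j k * lnk S0 a j * lnk S0 j k * lnk S0 k a
          + (if j = b then q a b k * lnk S0 b k * lnk S0 k a else 0)
          + (if k = b then q a b j * lnk S0 b j * lnk S0 j a else 0) := by
      intro j k
      by_cases hj : j = a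
      · subst hj
        simp [lnk_self', hab]
      by_cases hk : k = a
      · subst hk
        simp [lnk_self', hab]
      have e : lnk S1 j k = lnk S0 j k := by
        rw [hS1, hS0, lnk_setLink_other S a b j k hj hk, lnk_setLink_other S a b j k hj hk]
      rw [e, lnk_comm' S1 k a, hl, hl, lnk_comm' S0 a k]
      by_cases hjb : j = b
      · subst hjb
        by_cases hkb : k = j
        · subst hkb
          simp [lnk_self']
        · simp [hkb]; ring
      · by_cases hkb : k = b
        · subst hkb
          simp [hjb]
          rw [hq2 a k j, lnk_comm' S0 k j, lnk_comm' S0 j a]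
          ring
        · simp [hjb, hkb]
    simp only [hp, Finset.sum_add_distrib, Finset.sum_ite_eq', Finset.mem_univ, if_true]
    have : ∑ x, ∑ x_1, (if x = b then q a b x_1 * lnk S0 b x_1 * lnk S0 x_1 a else 0)
        = ∑ k, q a b k * lnk S0 b k * lnk S0 k a := by
      rw [Finset.sum_comm]
      simp
    rw [this]
    ring
  have hb : b ∈ univ.erase a := by simp [hab.symm]
  rw [hT]
  simp only [hl, add_mul, Finset.sum_add_distrib, ite_mul, one_mul, zero_mul,
    Finset.sum_ite_eq', hb, if_true]
  ring

theorem dLinkU_symm (v : Fin n → ℝ) (w : Fin n → Fin n → ℝ) (hw : ∀ i j, w i j = w j i)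
    (q : Fin n → Fin n → Fin n → ℝ)
    (hq1 : ∀ i j k, q i j k = q j i k) (hq2 : ∀ i j k, q i j k = q i k j)
    (h φ : ℝ) (a b : Fin n) (hab : a ≠ b) (S : NetState n) :
    dLinkU v w q h φ a b S = dLinkU v w q h φ b a S := by
  rw [dLinkU_eq v w q hq2 h φ a b hab, dLinkU_eq v w q hq2 h φ b a hab.symm, hw a b,
    setLink_comm' S b a]
  have : ∀ k, q a b k * lnk (setLink S a b false) b k * lnk (setLink S a b false) k a
      = q b a k * lnk (setLink S a b false) a k * lnk (setLink S a b false) k b := by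
    intro k
    rw [hq1 a b k, lnk_comm' _ b k, lnk_comm' _ k a]
    ring
  simp only [this]
  ring

theorem setLink_eq_self (S : NetState n) (a b : Fin n) (hS : S.1.2 a b = true) :
    setLink S a b true = S := by
  apply Subtype.ext
  unfold setLink
  refine Prod.ext rfl ?_
  funext p q
  dsimp only
  by_cases hpq : p = q
  · subst hpq; simp [S.2.2 p]
  · rw [if_neg hpq]
    split_ifs with hc
    · rcases hc with ⟨rfl, rfl⟩ | ⟨rfl, rfl⟩
      · exact hS.symm
      · rw [S.2.1, hS]
    · rfl

/-- Proposition 2, part 3: the NEkSN family is nested,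
`NEk'SN ⊆ NEkSN` for `1 < k ≤ k' ≤ n`. -/
theorem neksn_nested {n : ℕ} (hn : 2 ≤ n)
    (v : Fin n → ℝ) (w : Fin n → Fin n → ℝ) (hw : ∀ i j, w i j = w j i)
    (q : Fin n → Fin n → Fin n → ℝ)
    (hq1 : ∀ i j k, q i j k = q j i k) (hq2 : ∀ i j k, q i j k = q i k j)
    (h φ : ℝ) (k k' : ℕ) (hk1 : 1 < k) (hkk' : k ≤ k') (hk'n : k' ≤ n)
    (S : NetState n) (hS : isNEkSN v w q h φ k' S) :
    isNEkSN v w q h φ k S := by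
  intro μ
  obtain ⟨⟨i, I⟩, hi, hI⟩ := μ
  dsimp only at hi hI
  have hsub : I ⊆ univ.erase i := fun x hx => by
    simp only [Finset.mem_erase, Finset.mem_univ, and_true]
    rintro rfl
    exact hi hx
  have hcard : (univ.erase i : Finset (Fin n)).card = n - 1 := by
    rw [Finset.card_erase_of_mem (Finset.mem_univ _)]; simp
  obtain ⟨I', hII', hI'e, hI'⟩ := Finset.exists_subsuperset_card_eq hsub
    (show I.card ≤ k' - 1 by omega) (show k' - 1 ≤ (univ.erase i).card by omega)
  have hi' : i ∉ I' := fun hc => by simpa using hI'e hc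
  obtain ⟨hSf, hmax⟩ := hS ⟨(i, I'), hi', hI'⟩
  refine ⟨⟨by simp [nbhd], fun j hj hl => hSf.2 j (hII' hj) hl⟩, ?_⟩
  intro T hT
  have hTn : T ∈ nbhd (k := k') ⟨(i, I'), hi', hI'⟩ S := by
    have h0 := hT.1
    simp only [nbhd, Finset.mem_filter, Finset.mem_univ, true_and] at h0 ⊢
    refine ⟨h0.1, fun p r hpr => h0.2 p r fun hc => hpr ?_⟩
    rcases hc with ⟨h1, h2⟩ | ⟨h1, h2⟩
    · exact Or.inl ⟨h1, hII' h2⟩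
    · exact Or.inr ⟨h1, hII' h2⟩
  obtain ⟨M, hM, hMmax⟩ := Finset.exists_max_image _ (util v w q h φ i) ⟨T, hTn⟩
  refine (hMmax T hTn).trans (hmax M ⟨hM, ?_⟩)
  intro j hj hl
  have hj : j ∈ I' := hj
  have hij : i ≠ j := fun hc => hi' (hc ▸ hj)
  change 0 ≤ dLinkU v w q h φ j i M
  rw [← dLinkU_symm v w hw q hq1 hq2 h φ i j hij]
  unfold dLinkU
  rw [setLink_eq_self M i j hl]
  refine sub_nonneg.mpr (hMmax _ ?_)
  simp only [nbhd, Finset.mem_filter, Finset.mem_univ, true_and] at hM ⊢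
  refine ⟨hM.1, fun p r hpr => ?_⟩
  rw [← hM.2 p r hpr]
  unfold setLink
  dsimp only
  by_cases hp : p = r
  · subst hp; simp [M.2.2 p]
  · rw [if_neg hp, if_neg]
    rintro (⟨h1, h2⟩ | ⟨h1, h2⟩)
    · exact hpr (Or.inl ⟨h1, h2 ▸ hj⟩)
    · exact hpr (Or.inr ⟨h2, h1 ▸ hj⟩)

end NEkSN
end
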